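/- Let $(P_n)_{n\ge 1}$ be a sequence of bistochastic matrices, $P_n$ on a finite state space $\Omega_n$ with $|\Omega_n| = n$, and suppose there exists $\gamma > 0$ such that for all $n$ and all $x \in \Omega_n$, $P_n(x,x) \ge \gamma$. Let $\delta_n$ denote the minimal positive entry of $P_n$. For each $n$, let $\pi_n$ be a (deterministic) permutation of $\Omega_n$ such that there exists $\alpha_n \in (0,1)$ with $|\mathcal{E}(\pi_n(\mathcal{E}(A)))| \ge (1+\alpha_n)|A|$ for every $A \subseteq \Omega_n$ with $|A| \le n/2$. Then the chain $Q_n = P_n\Pi_n$ satisfies $\mathcal{D}^{(n)}\big(\lceil 17 \log n / (\alpha_n^2 \delta_n^4) \rceil\big) \to 0$ as $n \to \infty$. -/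

import Mathlib

open Finset Filter

noncomputable section

/-- A bistochastic matrix: nonnegative entries, all rows and columns sum to 1. -/
def Bistochastic {n : ℕ} (P : Matrix (Fin n) (Fin n) ℝ) : Prop :=
  (∀ x y, 0 ≤ P x y) ∧ (∀ x, ∑ y, P x y = 1) ∧ (∀ y, ∑ x, P x y = 1)

/-- The permutation matrix of a permutation: `Π x y = 1` iff `y = π x`. -/
def permMatrix {n : ℕ} (π : Equiv.Perm (Fin n)) : Matrix (Fin n) (Fin n) ℝ :=
  fun x y => if y = π x then 1 else 0

/-- Entropy rate of a bistochastic matrix. -/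
def entRate {n : ℕ} (P : Matrix (Fin n) (Fin n) ℝ) : ℝ :=
  (1 / n) * ∑ x, ∑ y, if 0 < P x y then P x y * Real.log (1 / P x y) else 0

/-- Minimal positive entry. -/
def minPosEntry {n : ℕ} (P : Matrix (Fin n) (Fin n) ℝ) : ℝ :=
  sInf {r : ℝ | 0 < r ∧ ∃ x y, P x y = r}

/-- Total variation distance to uniform at time `t` from `x`. -/
def tvFrom {n : ℕ} (Q : Matrix (Fin n) (Fin n) ℝ) (t : ℕ) (x : Fin n) : ℝ :=
  ∑ y, max ((1 : ℝ) / n - (Q ^ t) x y) 0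

/-- Worst-case total variation distance at time `t`. -/
def worstTV {n : ℕ} (Q : Matrix (Fin n) (Fin n) ℝ) (t : ℕ) : ℝ :=
  ⨆ x, tvFrom Q t x

/-- Mixing time. -/
def mixingTime {n : ℕ} (Q : Matrix (Fin n) (Fin n) ℝ) (ε : ℝ) : ℕ :=
  sInf {t : ℕ | worstTV Q t ≤ ε}

open Classical in
/-- Probability of an event under the uniform distribution on permutations. -/
def probPerm {n : ℕ} (E : Equiv.Perm (Fin n) → Prop) : ℝ :=
  (Finset.univ.filter E).card / (Fintype.card (Equiv.Perm (Fin n)))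


open Classical in
/-- The set of states attainable by `P` in one step starting from `A`. -/
def attain {n : ℕ} (P : Matrix (Fin n) (Fin n) ℝ) (A : Finset (Fin n)) : Finset (Fin n) :=
  Finset.univ.filter fun y => ∃ x ∈ A, 0 < P x y

/-! ### Cheeger's inequality for symmetric bistochastic kernels -/

section Cheeger

variable {ι : Type*} [Fintype ι]

/-- Layer-cake step of Cheeger's inequality: a lower bound on the boundary of all small sets
extends to nonnegative functions with small support. -/
lemma sum_le_sum_abs_sub_of_cut (K : ι → ι → ℝ) (Φ : ℝ)
    (hcut : ∀ A : Finset ι, 2 * A.card ≤ Fintype.card ι →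
      Φ * A.card ≤ ∑ x, ∑ y, K x y *
        |(A : Set ι).indicator (1 : ι → ℝ) x - (A : Set ι).indicator (1 : ι → ℝ) y|)
    (S : Finset ι) (hS : 2 * S.card ≤ Fintype.card ι) (h : ι → ℝ) (h0 : ∀ x, 0 ≤ h x)
    (hpos : ∀ x, 0 < h x ↔ x ∈ S) :
    Φ * ∑ x, h x ≤ ∑ x, ∑ y, K x y * |h x - h y| := by
  induction S using Finset.strongInduction generalizing h with
  | H S ih =>
    classical
    rcases S.eq_empty_or_nonempty with rfl | hne
    · have hz : ∀ x, h x = 0 := fun x =>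
        le_antisymm (not_lt.1 fun hx => by simpa using (hpos x).1 hx) (h0 x)
      simp [hz]
    · obtain ⟨a, ha, hmin⟩ := S.exists_min_image h hne
      set m := h a with hm
      have hm0 : 0 < m := (hpos a).2 ha
      set χ : ι → ℝ := (S : Set ι).indicator 1 with hχ
      have hχin : ∀ x ∈ S, χ x = 1 := fun x hx => by simp [hχ, hx]
      have hχout : ∀ x ∉ S, χ x = 0 := fun x hx => by simp [hχ, hx]
      have hout : ∀ x ∉ S, h x = 0 := fun x hx =>
        le_antisymm (not_lt.1 fun h' => hx ((hpos x).1 h')) (h0 x)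
      have hk0 : ∀ x, 0 ≤ h x - m * χ x := by
        intro x
        by_cases hx : x ∈ S
        · rw [hχin x hx]; linarith [hmin x hx]
        · rw [hχout x hx, hout x hx]; simp
      have hsub : (univ.filter fun x => 0 < h x - m * χ x) ⊂ S := by
        rw [Finset.ssubset_iff_of_subset]
        · exact ⟨a, ha, by simp [hχin a ha, hm]⟩
        · intro x hx
          by_contra hxS
          simp [hχout x hxS, hout x hxS] at hx
      have hrec := ih _ hsub (le_trans (by gcongr) hS)
        (fun x => h x - m * χ x) hk0 (by simp)
      have hsplit : ∀ x y, |h x - h y| =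
          m * |χ x - χ y| + |(h x - m * χ x) - (h y - m * χ y)| := by
        intro x y
        by_cases hx : x ∈ S <;> by_cases hy : y ∈ S
        · rw [hχin x hx, hχin y hy]; simp
        · have := hmin x hx
          rw [hχin x hx, hχout y hy, hout y hy]
          rw [abs_of_nonneg (by linarith), abs_of_nonneg (by linarith),
            abs_of_nonneg (by linarith)]
          ring
        · have := hmin y hy
          rw [hχin y hy, hχout x hx, hout x hx]
          rw [abs_of_nonpos (by linarith), abs_of_nonpos (by linarith),
            abs_of_nonpos (by linarith)]
          ring
        · rw [hχout x hx, hχout y hy, hout x hx, hout y hy]; simp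
      have hcard : ∑ x, χ x = S.card := by
        simp [hχ, Set.indicator_apply]
      have hcutS := mul_le_mul_of_nonneg_left (hcut S hS) hm0.le
      have hR : ∑ x, ∑ y, K x y * |h x - h y| =
          m * ∑ x, ∑ y, K x y * |χ x - χ y| +
            ∑ x, ∑ y, K x y * |(h x - m * χ x) - (h y - m * χ y)| := by
        simp only [Finset.mul_sum, ← Finset.sum_add_distrib]
        refine Finset.sum_congr rfl fun x _ => Finset.sum_congr rfl fun y _ => ?_
        rw [hsplit]; ring
      have hL : ∑ x, h x = m * S.card + ∑ x, (h x - m * χ x) := by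
        rw [Finset.sum_sub_distrib, ← Finset.mul_sum, hcard]; ring
      rw [hR, hL]
      linarith

/-- Cheeger's inequality for nonnegative functions supported on at most half of the space. -/
lemma cheeger_of_small_support (K : ι → ι → ℝ) (hK : ∀ x y, 0 ≤ K x y)
    (hrow : ∀ x, ∑ y, K x y = 1) (hcol : ∀ y, ∑ x, K x y = 1) (Φ : ℝ) (hΦ : 0 ≤ Φ)
    (hcut : ∀ A : Finset ι, 2 * A.card ≤ Fintype.card ι →
      Φ * A.card ≤ ∑ x, ∑ y, K x y *
        |(A : Set ι).indicator (1 : ι → ℝ) x - (A : Set ι).indicator (1 : ι → ℝ) y|)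
    (f : ι → ℝ) (f0 : ∀ x, 0 ≤ f x)
    (hf : 2 * (univ.filter fun x => 0 < f x).card ≤ Fintype.card ι) :
    Φ ^ 2 / 4 * ∑ x, f x ^ 2 ≤ ∑ x, ∑ y, K x y * (f x - f y) ^ 2 := by
  have hco := sum_le_sum_abs_sub_of_cut K Φ hcut _ hf (fun x => f x ^ 2)
    (fun x => sq_nonneg _) (fun x => by
      simp [(f0 x).lt_iff_ne, ne_comm, sq_pos_iff])
  set F := ∑ x, f x ^ 2
  have hF : 0 ≤ F := Finset.sum_nonneg fun _ _ => sq_nonneg _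
  have hCS := Finset.sum_mul_sq_le_sq_mul_sq (univ : Finset (ι × ι))
    (fun p => √(K p.1 p.2) * |f p.1 - f p.2|) (fun p => √(K p.1 p.2) * (f p.1 + f p.2))
  have e1 : ∑ p : ι × ι, (√(K p.1 p.2) * |f p.1 - f p.2|) * (√(K p.1 p.2) * (f p.1 + f p.2)) =
      ∑ x, ∑ y, K x y * |f x ^ 2 - f y ^ 2| := by
    rw [Fintype.sum_prod_type]
    refine Finset.sum_congr rfl fun x _ => Finset.sum_congr rfl fun y _ => ?_
    rw [sq_sub_sq, abs_mul, abs_of_nonneg (add_nonneg (f0 x) (f0 y))]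
    linear_combination (|f x - f y| * (f x + f y)) * Real.mul_self_sqrt (hK x y)
  have e2 : ∑ p : ι × ι, (√(K p.1 p.2) * |f p.1 - f p.2|) ^ 2 =
      ∑ x, ∑ y, K x y * (f x - f y) ^ 2 := by
    rw [Fintype.sum_prod_type]
    refine Finset.sum_congr rfl fun x _ => Finset.sum_congr rfl fun y _ => ?_
    rw [mul_pow, sq_abs, Real.sq_sqrt (hK x y)]
  have e3 : ∑ p : ι × ι, (√(K p.1 p.2) * (f p.1 + f p.2)) ^ 2 ≤ 4 * F := by
    rw [Fintype.sum_prod_type]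
    have hx : ∑ x, ∑ y, K x y * f x ^ 2 = F := by
      simp only [← Finset.sum_mul, hrow, one_mul, F]
    have hy : ∑ x, ∑ y, K x y * f y ^ 2 = F := by
      rw [Finset.sum_comm]; simp only [← Finset.sum_mul, hcol, one_mul, F]
    calc _ ≤ ∑ x, ∑ y, (2 * (K x y * f x ^ 2) + 2 * (K x y * f y ^ 2)) := by
          refine Finset.sum_le_sum fun x _ => Finset.sum_le_sum fun y _ => ?_
          rw [mul_pow, Real.sq_sqrt (hK x y)]
          nlinarith [mul_nonneg (hK x y) (sq_nonneg (f x - f y))]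
      _ = 4 * F := by
          simp only [Finset.sum_add_distrib, ← Finset.mul_sum, hx, hy]; ring
  rw [e1, e2] at hCS
  set E := ∑ x, ∑ y, K x y * (f x - f y) ^ 2
  have hE : 0 ≤ E := Finset.sum_nonneg fun x _ => Finset.sum_nonneg fun y _ =>
    mul_nonneg (hK x y) (sq_nonneg _)
  rcases hF.eq_or_lt with h | h
  · rw [← h]; simpa using hE
  · have h1 : (Φ * F) ^ 2 ≤ E * (4 * F) :=
      (pow_le_pow_left₀ (mul_nonneg hΦ hF) hco 2).trans
        (hCS.trans (mul_le_mul_of_nonneg_left e3 hE))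
    have h2 : (Φ ^ 2 / 4 * F) * (4 * F) ≤ E * (4 * F) := by linarith [h1]
    exact le_of_mul_le_mul_right h2 (by linarith)

/-- Every real function on a nonempty finite type has a median. -/
lemma exists_median [Nonempty ι] (g : ι → ℝ) :
    ∃ m : ℝ, 2 * (univ.filter fun x => m < g x).card ≤ Fintype.card ι ∧
      2 * (univ.filter fun x => g x < m).card ≤ Fintype.card ι := by
  classical
  obtain ⟨b, -, hb⟩ := (univ : Finset ι).exists_max_image g univ_nonempty
  have hb' : (univ.filter fun x => g b < g x) = ∅ := by
    simpa [Finset.filter_eq_empty_iff] using hb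
  obtain ⟨a, ha, hmin⟩ :=
    (univ.filter fun a => 2 * (univ.filter fun x => g a < g x).card ≤ Fintype.card ι).exists_min_image
      g ⟨b, by simp [hb']⟩
  refine ⟨g a, by simpa using ha, ?_⟩
  by_contra! hlt
  obtain ⟨c, hc, hmax⟩ := (univ.filter fun x => g x < g a).exists_max_image g
    (Finset.card_pos.1 (by omega))
  have hcomp := Finset.card_filter_add_card_filter_not (s := (univ : Finset ι)) (fun x => g x < g a)
  have hle : (univ.filter fun x => g c < g x).card ≤ (univ.filter fun x => ¬ g x < g a).card := by
    refine Finset.card_le_card fun x hx => ?_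
    simp only [Finset.mem_filter, Finset.mem_univ, true_and] at hx hmax ⊢
    exact fun h => absurd (hmax x h) (not_le.2 hx)
  rw [Finset.card_univ] at hcomp
  have := hmin c (by simp only [Finset.mem_filter, Finset.mem_univ, true_and]; omega)
  simp only [Finset.mem_filter, Finset.mem_univ, true_and] at hc
  linarith

/-- Cheeger's inequality for a bistochastic kernel. -/
lemma cheeger_inequality [Nonempty ι] (K : ι → ι → ℝ) (hK : ∀ x y, 0 ≤ K x y)
    (hrow : ∀ x, ∑ y, K x y = 1) (hcol : ∀ y, ∑ x, K x y = 1) (Φ : ℝ) (hΦ : 0 ≤ Φ)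
    (hcut : ∀ A : Finset ι, 2 * A.card ≤ Fintype.card ι →
      Φ * A.card ≤ ∑ x, ∑ y, K x y *
        |(A : Set ι).indicator (1 : ι → ℝ) x - (A : Set ι).indicator (1 : ι → ℝ) y|)
    (g : ι → ℝ) (hg : ∑ x, g x = 0) :
    Φ ^ 2 / 4 * ∑ x, g x ^ 2 ≤ ∑ x, ∑ y, K x y * (g x - g y) ^ 2 := by
  obtain ⟨m, hm1, hm2⟩ := exists_median g
  have hp := cheeger_of_small_support K hK hrow hcol Φ hΦ hcut (fun x => max (g x - m) 0)
    (fun x => le_max_right _ _) (by simpa [lt_max_iff] using hm1)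
  have hn := cheeger_of_small_support K hK hrow hcol Φ hΦ hcut (fun x => max (m - g x) 0)
    (fun x => le_max_right _ _) (by simpa [lt_max_iff] using hm2)
  have hsq : ∑ x, g x ^ 2 ≤ ∑ x, (max (g x - m) 0) ^ 2 + ∑ x, (max (m - g x) 0) ^ 2 := by
    have h1 : ∑ x, (max (g x - m) 0) ^ 2 + ∑ x, (max (m - g x) 0) ^ 2 =
        ∑ x, (g x ^ 2 - 2 * m * g x + m ^ 2) := by
      rw [← Finset.sum_add_distrib]
      refine Finset.sum_congr rfl fun x _ => ?_
      rcases le_total (g x) m with h | h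
      · rw [max_eq_right (by linarith), max_eq_left (by linarith)]; ring
      · rw [max_eq_left (by linarith), max_eq_right (by linarith)]; ring
    rw [h1, Finset.sum_add_distrib, Finset.sum_sub_distrib, ← Finset.mul_sum, hg]
    have : (0 : ℝ) ≤ ∑ _x : ι, m ^ 2 := Finset.sum_nonneg fun _ _ => sq_nonneg _
    linarith
  have hEn : ∑ x, ∑ y, K x y * (max (g x - m) 0 - max (g y - m) 0) ^ 2 +
      ∑ x, ∑ y, K x y * (max (m - g x) 0 - max (m - g y) 0) ^ 2 ≤
      ∑ x, ∑ y, K x y * (g x - g y) ^ 2 := by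
    simp only [← Finset.sum_add_distrib, ← mul_add]
    refine Finset.sum_le_sum fun x _ => Finset.sum_le_sum fun y _ =>
      mul_le_mul_of_nonneg_left ?_ (hK x y)
    rcases le_total (g x) m with h | h <;> rcases le_total (g y) m with h' | h'
    · rw [max_eq_right (by linarith), max_eq_right (by linarith), max_eq_left (by linarith),
        max_eq_left (by linarith)]
      linarith [sq_nonneg (g x - g y)]
    · rw [max_eq_right (by linarith), max_eq_left (by linarith), max_eq_left (by linarith),
        max_eq_right (by linarith)]
      nlinarith [mul_nonneg (sub_nonneg.2 h) (sub_nonneg.2 h')]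
    · rw [max_eq_left (by linarith), max_eq_right (by linarith), max_eq_right (by linarith),
        max_eq_left (by linarith)]
      nlinarith [mul_nonneg (sub_nonneg.2 h) (sub_nonneg.2 h')]
    · rw [max_eq_left (by linarith), max_eq_left (by linarith), max_eq_right (by linarith),
        max_eq_right (by linarith)]
      linarith [sq_nonneg (g x - g y)]
  have := mul_le_mul_of_nonneg_left hsq (by positivity : 0 ≤ Φ ^ 2 / 4)
  linarith

end Cheeger

/-! ### Contraction of bistochastic matrices -/

section Contraction

variable {n : ℕ}

lemma Bistochastic.mul {A B : Matrix (Fin n) (Fin n) ℝ} (hA : Bistochastic A)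
    (hB : Bistochastic B) : Bistochastic (A * B) := by
  refine ⟨fun x y => ?_, fun x => ?_, fun y => ?_⟩
  · rw [Matrix.mul_apply]
    exact Finset.sum_nonneg fun z _ => mul_nonneg (hA.1 _ _) (hB.1 _ _)
  · simp only [Matrix.mul_apply]
    rw [Finset.sum_comm]
    simp only [← Finset.mul_sum, hB.2.1, mul_one, hA.2.1]
  · simp only [Matrix.mul_apply]
    rw [Finset.sum_comm]
    simp only [← Finset.sum_mul, hA.2.2, one_mul, hB.2.2]

lemma Bistochastic.transpose {A : Matrix (Fin n) (Fin n) ℝ} (hA : Bistochastic A) :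
    Bistochastic A.transpose :=
  ⟨fun x y => hA.1 y x, hA.2.2, hA.2.1⟩

lemma bistochastic_one : Bistochastic (1 : Matrix (Fin n) (Fin n) ℝ) :=
  ⟨fun x y => by rw [Matrix.one_apply]; split_ifs <;> norm_num,
    fun x => by simp [Matrix.one_apply], fun x => by simp [Matrix.one_apply]⟩

lemma bistochastic_permMatrix (σ : Equiv.Perm (Fin n)) : Bistochastic (permMatrix σ) :=
  ⟨fun x y => by unfold permMatrix; split_ifs <;> norm_num,
    fun x => by simp [permMatrix],
    fun y => by simp [permMatrix, ← Equiv.symm_apply_eq]⟩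

lemma Bistochastic.pow {A : Matrix (Fin n) (Fin n) ℝ} (hA : Bistochastic A) (t : ℕ) :
    Bistochastic (A ^ t) := by
  induction t with
  | zero => simpa using bistochastic_one
  | succ t ih => rw [pow_succ]; exact ih.mul hA

lemma Bistochastic.le_one {A : Matrix (Fin n) (Fin n) ℝ} (hA : Bistochastic A)
    (x y : Fin n) : A x y ≤ 1 := by
  rw [← hA.2.1 x]
  exact Finset.single_le_sum (fun z _ => hA.1 x z) (Finset.mem_univ y)

lemma mul_permMatrix_apply (A : Matrix (Fin n) (Fin n) ℝ) (σ : Equiv.Perm (Fin n))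
    (x y : Fin n) : (A * permMatrix σ) x y = A x (σ.symm y) := by
  simp [Matrix.mul_apply, permMatrix, ← Equiv.symm_apply_eq]

/-- The Dirichlet form of `M * Mᵀ` measures the loss of `ℓ²` norm under `g ↦ g ᵥ* M`. -/
lemma Bistochastic.dirichlet_eq {M : Matrix (Fin n) (Fin n) ℝ} (hM : Bistochastic M)
    (g : Fin n → ℝ) :
    ∑ x, ∑ y, (M * M.transpose) x y * (g x - g y) ^ 2 =
      2 * ∑ x, g x ^ 2 - 2 * ∑ z, (Matrix.vecMul g M z) ^ 2 := by
  have hK := hM.mul hM.transpose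
  have hx : ∑ x, ∑ y, (M * M.transpose) x y * g x ^ 2 = ∑ x, g x ^ 2 := by
    simp only [← Finset.sum_mul, hK.2.1, one_mul]
  have hy : ∑ x, ∑ y, (M * M.transpose) x y * g y ^ 2 = ∑ x, g x ^ 2 := by
    rw [Finset.sum_comm]; simp only [← Finset.sum_mul, hK.2.2, one_mul]
  have hxy : ∑ x, ∑ y, (M * M.transpose) x y * (g x * g y) =
      ∑ z, (Matrix.vecMul g M z) ^ 2 := by
    have : ∀ z, (Matrix.vecMul g M z) ^ 2 = ∑ x, ∑ y, (M x z * M y z) * (g x * g y) := by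
      intro z
      rw [sq, Matrix.vecMul, dotProduct, Finset.sum_mul_sum]
      exact Finset.sum_congr rfl fun x _ => Finset.sum_congr rfl fun y _ => by ring
    simp only [this, Matrix.mul_apply, Matrix.transpose_apply, Finset.sum_mul]
    rw [Finset.sum_comm (s := univ) (t := univ)
      (f := fun z x => ∑ y, M x z * M y z * (g x * g y))]
    exact Finset.sum_congr rfl fun x _ => Finset.sum_comm
  calc _ = ∑ x, ∑ y, ((M * M.transpose) x y * g x ^ 2 + (M * M.transpose) x y * g y ^ 2
          - 2 * ((M * M.transpose) x y * (g x * g y))) :=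
        Finset.sum_congr rfl fun x _ => Finset.sum_congr rfl fun y _ => by ring
    _ = _ := by
        simp only [Finset.sum_sub_distrib, Finset.sum_add_distrib, ← Finset.mul_sum, hx, hy, hxy]
        ring

/-- A bistochastic matrix whose positive entries are at least `η` and whose support expands
small sets by a factor `1 + a` contracts mean-zero vectors. -/
lemma Bistochastic.sum_vecMul_sq_le [NeZero n] {M : Matrix (Fin n) (Fin n) ℝ}
    (hM : Bistochastic M) {a η : ℝ} (ha : 0 ≤ a) (hη : 0 ≤ η)
    (hentry : ∀ x y, 0 < M x y → η ≤ M x y)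
    (hexp : ∀ A : Finset (Fin n), (A.card : ℝ) ≤ n / 2 →
      (1 + a) * (A.card : ℝ) ≤ ((attain M A).card : ℝ))
    (g : Fin n → ℝ) (hg : ∑ x, g x = 0) :
    ∑ z, (Matrix.vecMul g M z) ^ 2 ≤ (1 - (a * η) ^ 2 / 2) * ∑ x, g x ^ 2 := by
  have hK := hM.mul hM.transpose
  have hch := cheeger_inequality (M * M.transpose) hK.1 hK.2.1 hK.2.2 (2 * (a * η))
    (by positivity) ?_ g hg
  · rw [hM.dirichlet_eq] at hch
    linarith
  intro A hA
  have hA' : (A.card : ℝ) ≤ n / 2 := by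
    rw [Fintype.card_fin] at hA
    have : (2 * A.card : ℝ) ≤ n := by exact_mod_cast hA
    linarith
  set χ : Fin n → ℝ := (A : Set (Fin n)).indicator 1 with hχ
  have habs : ∀ x y, |χ x - χ y| = (χ x - χ y) ^ 2 := by
    intro x y
    by_cases hx : x ∈ A <;> by_cases hy : y ∈ A <;> simp [hχ, hx, hy]
  have hχsq : ∑ x, χ x ^ 2 = A.card := by
    simp [hχ, Set.indicator_apply]
  have hu : ∀ z, Matrix.vecMul χ M z = ∑ x ∈ A, M x z := by
    intro z
    simp [Matrix.vecMul, dotProduct, hχ, Set.indicator_apply]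
  simp only [habs]
  rw [hM.dirichlet_eq, hχsq]
  simp only [hu]
  set u : Fin n → ℝ := fun z => ∑ x ∈ A, M x z
  have husum : ∑ z, u z = A.card := by
    rw [Finset.sum_comm]; simp [hM.2.1]
  have hu0 : ∀ z, 0 ≤ u z := fun z => Finset.sum_nonneg fun x _ => hM.1 x z
  have hu1 : ∀ z, u z ≤ 1 := fun z => by
    rw [← hM.2.2 z]
    exact Finset.sum_le_sum_of_subset_of_nonneg (Finset.subset_univ A) fun x _ _ => hM.1 x z
  have hlow : ∀ z, η * ((if z ∈ attain M A then 1 else 0) - u z) ≤ u z - u z ^ 2 := by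
    intro z
    split_ifs with hz
    · simp only [attain, Finset.mem_filter, Finset.mem_univ, true_and] at hz
      obtain ⟨x, hx, hxz⟩ := hz
      have hηu : η ≤ u z := (hentry x z hxz).trans
        (Finset.single_le_sum (f := fun x => M x z) (fun y _ => hM.1 y z) hx)
      nlinarith [mul_nonneg (sub_nonneg.2 hηu) (sub_nonneg.2 (hu1 z))]
    · nlinarith [mul_nonneg hη (hu0 z), mul_nonneg (hu0 z) (sub_nonneg.2 (hu1 z))]
  have hsum := Finset.sum_le_sum fun z (_ : z ∈ (univ : Finset (Fin n))) => hlow z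
  rw [← Finset.mul_sum, Finset.sum_sub_distrib, Finset.sum_sub_distrib, husum,
    Finset.sum_ite_mem, Finset.univ_inter, Finset.sum_const, nsmul_eq_mul, mul_one] at hsum
  have := mul_le_mul_of_nonneg_left (hexp A hA') hη
  linarith

/-- Iterating a two-step `ℓ²` contraction on mean-zero vectors. -/
lemma Bistochastic.sum_pow_sub_sq_le {Q : Matrix (Fin n) (Fin n) ℝ}
    (hQ : Bistochastic Q) {ε : ℝ} (hε : ε ≤ 1)
    (hcontr : ∀ g : Fin n → ℝ, ∑ x, g x = 0 →
      ∑ z, (Matrix.vecMul g (Q ^ 2) z) ^ 2 ≤ (1 - ε) * ∑ x, g x ^ 2)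
    (x : Fin n) (t : ℕ) :
    ∑ y, ((Q ^ t) x y - 1 / n) ^ 2 ≤ (1 - ε) ^ (t / 2) := by
  have hn : (n : ℝ) ≠ 0 := by
    have := x.pos
    positivity
  have hmean : ∀ s, ∑ y, ((Q ^ s) x y - 1 / n) = 0 := by
    intro s
    rw [Finset.sum_sub_distrib, (hQ.pow s).2.1]
    simp [hn]
  have hone : ∀ s, ∑ y, ((Q ^ s) x y - 1 / n) ^ 2 ≤ 1 := by
    intro s
    calc ∑ y, ((Q ^ s) x y - 1 / n) ^ 2
        = ∑ y, ((Q ^ s) x y ^ 2 - 1 / n * (Q ^ s) x y - 1 / n * ((Q ^ s) x y - 1 / n)) :=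
          Finset.sum_congr rfl fun y _ => by ring
      _ = ∑ y, ((Q ^ s) x y ^ 2 - 1 / n * (Q ^ s) x y) := by
          rw [Finset.sum_sub_distrib, ← Finset.mul_sum, hmean, mul_zero, sub_zero]
      _ ≤ ∑ y, (Q ^ s) x y := by
          refine Finset.sum_le_sum fun y _ => ?_
          have h0 := (hQ.pow s).1 x y
          have h1 := (hQ.pow s).le_one x y
          have : 0 ≤ 1 / (n : ℝ) * (Q ^ s) x y := by positivity
          nlinarith
      _ = 1 := (hQ.pow s).2.1 x
  induction t using Nat.twoStepInduction with
  | zero => simpa using hone 0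
  | one => simpa using hone 1
  | more t ih _ =>
    have hstep : ∀ y, (Q ^ (t + 2)) x y - 1 / n =
        Matrix.vecMul (fun z => (Q ^ t) x z - 1 / n) (Q ^ 2) y := by
      intro y
      rw [pow_add, Matrix.mul_apply]
      simp only [Matrix.vecMul, dotProduct, sub_mul, Finset.sum_sub_distrib, ← Finset.mul_sum,
        (hQ.pow 2).2.2, mul_one]
    simp only [hstep]
    have hdiv : (t + 2) / 2 = t / 2 + 1 := by omega
    rw [hdiv, pow_succ' (1 - ε)]
    exact (hcontr _ (hmean t)).trans (mul_le_mul_of_nonneg_left ih (by linarith))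

lemma tvFrom_sq_le (Q : Matrix (Fin n) (Fin n) ℝ) (t : ℕ) (x : Fin n) :
    tvFrom Q t x ^ 2 ≤ n * ∑ y, ((Q ^ t) x y - 1 / n) ^ 2 := by
  have h := sq_sum_le_card_mul_sum_sq (s := (univ : Finset (Fin n)))
    (f := fun y => max ((1 : ℝ) / n - (Q ^ t) x y) 0)
  rw [Finset.card_univ, Fintype.card_fin] at h
  refine h.trans (mul_le_mul_of_nonneg_left (Finset.sum_le_sum fun y _ => ?_) n.cast_nonneg)
  rcases le_total ((1 : ℝ) / n - (Q ^ t) x y) 0 with h | h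
  · rw [max_eq_right h]; nlinarith [sq_nonneg ((Q ^ t) x y - 1 / n)]
  · rw [max_eq_left h]; linarith [sub_sq_comm ((1 : ℝ) / n) ((Q ^ t) x y)]

lemma tvFrom_nonneg (Q : Matrix (Fin n) (Fin n) ℝ) (t : ℕ) (x : Fin n) : 0 ≤ tvFrom Q t x :=
  Finset.sum_nonneg fun _ _ => le_max_right _ _

end Contraction

/-! ### The chain `P * Π` -/

section Chain

variable {n : ℕ} {P : Matrix (Fin n) (Fin n) ℝ}

lemma minPosEntry_le (x y : Fin n) (h : 0 < P x y) : minPosEntry P ≤ P x y :=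
  csInf_le ⟨0, fun _ hr => hr.1.le⟩ ⟨h, x, y, rfl⟩

lemma Bistochastic.exists_pos (hP : Bistochastic P) (x : Fin n) : ∃ y, 0 < P x y := by
  by_contra! h
  have := Finset.sum_nonpos fun y (_ : y ∈ (univ : Finset (Fin n))) => h y
  rw [hP.2.1] at this
  linarith

lemma Bistochastic.minPosEntry_pos [NeZero n] (hP : Bistochastic P) : 0 < minPosEntry P := by
  have hfin : {r : ℝ | 0 < r ∧ ∃ x y, P x y = r}.Finite :=
    (Set.finite_range fun p : Fin n × Fin n => P p.1 p.2).subset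
      fun r ⟨_, x, y, h⟩ => ⟨(x, y), h⟩
  obtain ⟨y, hy⟩ := hP.exists_pos 0
  have hne : {r : ℝ | 0 < r ∧ ∃ x y, P x y = r}.Nonempty := ⟨P 0 y, hy, 0, y, rfl⟩
  exact (hne.csInf_mem hfin).1

lemma Bistochastic.minPosEntry_le_one [NeZero n] (hP : Bistochastic P) : minPosEntry P ≤ 1 := by
  obtain ⟨y, hy⟩ := hP.exists_pos 0
  exact (minPosEntry_le 0 y hy).trans (hP.le_one 0 y)

lemma mul_permMatrix_mul_apply (σ : Equiv.Perm (Fin n)) (x z : Fin n) :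
    (P * permMatrix σ * P) x z = ∑ y, P x y * P (σ y) z := by
  rw [Matrix.mul_apply, ← Equiv.sum_comp σ]
  simp [mul_permMatrix_apply]

lemma Bistochastic.mul_permMatrix_mul_pos_iff (hP : Bistochastic P) (σ : Equiv.Perm (Fin n))
    (x z : Fin n) :
    0 < (P * permMatrix σ * P) x z ↔ ∃ y, 0 < P x y ∧ 0 < P (σ y) z := by
  rw [mul_permMatrix_mul_apply,
    Finset.sum_pos_iff_of_nonneg fun y _ => mul_nonneg (hP.1 _ _) (hP.1 _ _)]
  refine ⟨fun ⟨y, _, h⟩ => ⟨y, ?_, ?_⟩, fun ⟨y, h1, h2⟩ => ⟨y, Finset.mem_univ y, mul_pos h1 h2⟩⟩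
  · exact pos_of_mul_pos_left h (hP.1 _ _)
  · exact pos_of_mul_pos_right h (hP.1 _ _)

lemma Bistochastic.attain_mul_permMatrix_mul (hP : Bistochastic P) (σ : Equiv.Perm (Fin n))
    (A : Finset (Fin n)) :
    attain (P * permMatrix σ * P) A = attain P ((attain P A).image σ) := by
  ext z
  simp only [attain, Finset.mem_filter, Finset.mem_univ, true_and, Finset.mem_image,
    hP.mul_permMatrix_mul_pos_iff]
  constructor
  · rintro ⟨x, hx, y, h1, h2⟩
    exact ⟨σ y, ⟨y, ⟨x, hx, h1⟩, rfl⟩, h2⟩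
  · rintro ⟨_, ⟨y, ⟨x, hx, h1⟩, rfl⟩, h2⟩
    exact ⟨x, hx, y, h1, h2⟩

lemma Bistochastic.minPosEntry_sq_le (hP : Bistochastic P) (hδ : 0 ≤ minPosEntry P)
    (σ : Equiv.Perm (Fin n)) (x z : Fin n) (h : 0 < (P * permMatrix σ * P) x z) :
    minPosEntry P ^ 2 ≤ (P * permMatrix σ * P) x z := by
  obtain ⟨y, h1, h2⟩ := (hP.mul_permMatrix_mul_pos_iff σ x z).1 h
  rw [mul_permMatrix_mul_apply, sq]
  exact (mul_le_mul (minPosEntry_le _ _ h1) (minPosEntry_le _ _ h2) hδ h1.le).trans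
    (Finset.single_le_sum (f := fun y => P x y * P (σ y) z)
      (fun y _ => mul_nonneg (hP.1 _ _) (hP.1 _ _)) (Finset.mem_univ y))

/-- Two steps of `P * Π` contract mean-zero vectors in `ℓ²`. -/
lemma Bistochastic.sum_vecMul_chain_sq_le [NeZero n] (hP : Bistochastic P)
    (σ : Equiv.Perm (Fin n)) {a : ℝ} (ha : 0 ≤ a)
    (hexp : ∀ A : Finset (Fin n), (A.card : ℝ) ≤ n / 2 →
      (1 + a) * (A.card : ℝ) ≤ ((attain P ((attain P A).image σ)).card : ℝ))
    (g : Fin n → ℝ) (hg : ∑ x, g x = 0) :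
    ∑ z, (Matrix.vecMul g ((P * permMatrix σ) ^ 2) z) ^ 2 ≤
      (1 - a ^ 2 * minPosEntry P ^ 4 / 2) * ∑ x, g x ^ 2 := by
  have hδ := hP.minPosEntry_pos.le
  have h := ((hP.mul (bistochastic_permMatrix σ)).mul hP).sum_vecMul_sq_le ha (sq_nonneg _)
    (hP.minPosEntry_sq_le hδ σ) (by simpa only [hP.attain_mul_permMatrix_mul] using hexp) g hg
  have hperm : ∀ z, Matrix.vecMul g ((P * permMatrix σ) ^ 2) z =
      Matrix.vecMul g (P * permMatrix σ * P) (σ.symm z) := by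
    intro z
    rw [sq, ← Matrix.mul_assoc]
    simp only [Matrix.vecMul, dotProduct, mul_permMatrix_apply]
  simp only [hperm]
  rw [Equiv.sum_comp σ.symm fun z => (Matrix.vecMul g (P * permMatrix σ * P) z) ^ 2]
  exact h.trans_eq (by ring)

/-- Quantitative mixing estimate for `P * Π`. -/
lemma Bistochastic.tvFrom_chain_le [NeZero n] (hP : Bistochastic P)
    (σ : Equiv.Perm (Fin n)) {a : ℝ} (ha : a ∈ Set.Ioo (0 : ℝ) 1)
    (hexp : ∀ A : Finset (Fin n), (A.card : ℝ) ≤ n / 2 →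
      (1 + a) * (A.card : ℝ) ≤ ((attain P ((attain P A).image σ)).card : ℝ)) (x : Fin n) :
    tvFrom (P * permMatrix σ) ⌈17 * Real.log n / (a ^ 2 * minPosEntry P ^ 4)⌉₊ x ≤ 2 / n := by
  set t := ⌈17 * Real.log n / (a ^ 2 * minPosEntry P ^ 4)⌉₊
  set κ := a ^ 2 * minPosEntry P ^ 4
  have hδ := hP.minPosEntry_pos
  have hκ0 : 0 < κ := mul_pos (pow_pos ha.1 2) (pow_pos hδ 4)
  have hκ1 : κ ≤ 1 := mul_le_one₀ (pow_le_one₀ ha.1.le ha.2.le) (by positivity)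
    (pow_le_one₀ hδ.le hP.minPosEntry_le_one)
  have hn : (0 : ℝ) < n := by exact_mod_cast Nat.pos_of_ne_zero (NeZero.ne n)
  have hlog : 0 ≤ Real.log n := Real.log_natCast_nonneg n
  have hbound := (hP.mul (bistochastic_permMatrix σ)).sum_pow_sub_sq_le
    (by linarith : κ / 2 ≤ 1) (hP.sum_vecMul_chain_sq_le σ ha.1.le hexp) x t
  have hκt : 17 * Real.log n ≤ κ * t := by
    rw [← div_le_iff₀' hκ0]; exact Nat.le_ceil _
  have hhalf : (t : ℝ) ≤ 2 * ((t / 2 : ℕ) : ℝ) + 1 := by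
    exact_mod_cast (by omega : t ≤ 2 * (t / 2) + 1)
  have hexpo : (1 - κ / 2) ^ (t / 2) ≤ Real.exp 1 * ((n : ℝ) ^ 3)⁻¹ := by
    calc (1 - κ / 2) ^ (t / 2) ≤ Real.exp (-(κ / 2)) ^ (t / 2) :=
          pow_le_pow_left₀ (by linarith) (Real.one_sub_le_exp_neg _) _
      _ = Real.exp (-(κ / 2) * ((t / 2 : ℕ) : ℝ)) := by rw [← Real.exp_nat_mul, mul_comm]
      _ ≤ Real.exp (1 + -(3 * Real.log n)) := by
          refine Real.exp_le_exp.2 ?_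
          have := mul_le_mul_of_nonneg_left hhalf hκ0.le
          linarith
      _ = Real.exp 1 * ((n : ℝ) ^ 3)⁻¹ := by
          rw [Real.exp_add, Real.exp_neg, ← Real.log_rpow hn, Real.exp_log (by positivity)]
          norm_cast
  have hsq : tvFrom (P * permMatrix σ) t x ^ 2 ≤ (2 / n : ℝ) ^ 2 := by
    calc tvFrom (P * permMatrix σ) t x ^ 2 ≤ n * (Real.exp 1 * ((n : ℝ) ^ 3)⁻¹) :=
          (tvFrom_sq_le _ t x).trans
            (mul_le_mul_of_nonneg_left (hbound.trans hexpo) hn.le)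
      _ = Real.exp 1 * ((n : ℝ) ^ 2)⁻¹ := by field_simp
      _ ≤ 4 * ((n : ℝ) ^ 2)⁻¹ := by
          gcongr
          linarith [Real.exp_one_lt_d9]
      _ = (2 / n : ℝ) ^ 2 := by rw [div_pow]; ring
  exact le_of_sq_le_sq hsq (by positivity)

end Chain

/-- Theorem 1.4: if `Pₙ` has laziness `γ > 0` and `πₙ` satisfies the
expansion condition with parameter `αₙ`, then the total-variation distance of `Qₙ = Pₙ Πₙ`
at time `⌈17 log n / (αₙ² δₙ⁴)⌉` tends to `0`. -/
theorem deterministic_permutation_mixing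
    (P : (n : ℕ) → Matrix (Fin n) (Fin n) ℝ)
    (hbis : ∀ n, Bistochastic (P n))
    (γ : ℝ) (hγ : 0 < γ) (hlazy : ∀ n (x : Fin n), γ ≤ P n x x)
    (π : (n : ℕ) → Equiv.Perm (Fin n))
    (α : ℕ → ℝ) (hα : ∀ n, α n ∈ Set.Ioo (0 : ℝ) 1)
    (hexp : ∀ n (A : Finset (Fin n)), (A.card : ℝ) ≤ n / 2 →
      (1 + α n) * (A.card : ℝ) ≤ ((attain (P n) ((attain (P n) A).image (π n))).card : ℝ)) :
    Tendsto (fun n => worstTV (P n * permMatrix (π n))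
        ⌈17 * Real.log n / ((α n) ^ 2 * (minPosEntry (P n)) ^ 4)⌉₊)
      atTop (nhds 0) := by
  refine squeeze_zero' (g := fun n : ℕ => (2 : ℝ) / n) ?_ ?_
    (tendsto_const_div_atTop_nhds_zero_nat 2)
  · exact Eventually.of_forall fun n => Real.iSup_nonneg fun x => tvFrom_nonneg _ _ x
  · filter_upwards [eventually_ge_atTop 1] with n hn
    have : NeZero n := ⟨by omega⟩
    exact ciSup_le fun x => (hbis n).tvFrom_chain_le (π n) (hα n) (hexp n) x

end
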